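/- Let r > 0, α ∈ (0,1], Q ∈ 𝕊^d, q ∈ ℝ^d, and let P₀ be a Borel probability measure on ℝ^d with finite second moment. Define φ(τ,γ,z) := sup_{v∈ℝ^d} { (vᵀQv + 2qᵀv − τ)₊ − γ‖v − z‖² } ∈ [0,+∞]. Then restricting the dual feasible set for γ from ℝ₊ to Γ := {γ ≥ 0 : γI − Q ≻ 0} does not change the infimum: inf_{τ∈ℝ, γ≥0} { τ + (1/α)( γr² + E_{P₀}[φ(τ,γ,z)] ) } = inf_{τ∈ℝ, γ∈Γ} { τ + (1/α)( γr² + E_{P₀}[ ( (γz+q)ᵀ(γI−Q)^{-1}(γz+q) − γ‖z‖² − τ )₊ ] ) }, where expectations of nonnegative extended-real functions are taken in [0,+∞]. -/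

import Mathlib

open MeasureTheory RealInnerProductSpace ENNReal

noncomputable section

/-- The function `φ(τ, γ, z) = sup_v { (ℓ(v) - τ)₊ - γ‖v - z‖² }` for the quadratic loss
`ℓ(v) = vᵀQv + 2qᵀv`, with values in `[0, ∞]` (the supremum is nonnegative since `v = z`
is feasible, so clamping each term at `0` via `ENNReal.ofReal` preserves it). -/
def phiQuad {d : ℕ} (Q : Matrix (Fin d) (Fin d) ℝ) (q : EuclideanSpace ℝ (Fin d))
    (τ γ : ℝ) (z : EuclideanSpace ℝ (Fin d)) : ℝ≥0∞ :=
  ⨆ v : EuclideanSpace ℝ (Fin d),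
    ENNReal.ofReal (max (⟪v, Matrix.toEuclideanLin Q v⟫ + 2 * ⟪q, v⟫ - τ) 0 - γ * ‖v - z‖ ^ 2)

theorem posSemidef_iff_inner_toEuclideanLin {d : ℕ} {A : Matrix (Fin d) (Fin d) ℝ} :
    A.PosSemidef ↔ A.IsHermitian ∧
      ∀ v : EuclideanSpace ℝ (Fin d), 0 ≤ ⟪v, Matrix.toEuclideanLin A v⟫ := by
  rw [Matrix.posSemidef_iff_dotProduct_mulVec]
  refine and_congr_right fun _ => ⟨fun h v => ?_, fun h x => ?_⟩
  · rw [EuclideanSpace.inner_eq_star_dotProduct, dotProduct_comm]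
    exact h v.ofLp
  · have := h (WithLp.toLp 2 x)
    rwa [EuclideanSpace.inner_eq_star_dotProduct, dotProduct_comm] at this

theorem toEuclideanLin_smul_one_sub {d : ℕ} (Q : Matrix (Fin d) (Fin d) ℝ) (γ : ℝ)
    (v : EuclideanSpace ℝ (Fin d)) :
    Matrix.toEuclideanLin (γ • (1 : Matrix (Fin d) (Fin d) ℝ) - Q) v
      = γ • v - Matrix.toEuclideanLin Q v := by
  ext i
  simp

theorem toEuclideanLin_apply_inv {d : ℕ} {A : Matrix (Fin d) (Fin d) ℝ} (hA : A.PosDef)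
    (w : EuclideanSpace ℝ (Fin d)) :
    Matrix.toEuclideanLin A (Matrix.toEuclideanLin A⁻¹ w) = w := by
  ext i
  simp [Matrix.mulVec_mulVec, Matrix.mul_nonsing_inv A hA.det_pos.ne'.isUnit]

theorem phiQuad_eq_iSup {d : ℕ} (Q : Matrix (Fin d) (Fin d) ℝ) (q : EuclideanSpace ℝ (Fin d))
    {γ : ℝ} (hγ : 0 ≤ γ) (τ : ℝ) (z : EuclideanSpace ℝ (Fin d)) :
    phiQuad Q q τ γ z = ⨆ v : EuclideanSpace ℝ (Fin d),
      ENNReal.ofReal (⟪v, Matrix.toEuclideanLin Q v⟫ + 2 * ⟪q, v⟫ - τ - γ * ‖v - z‖ ^ 2) := by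
  refine iSup_congr fun v => ?_
  have h : 0 ≤ γ * ‖v - z‖ ^ 2 := by positivity
  rw [← max_sub_sub_right, zero_sub, ENNReal.ofReal_max,
    ENNReal.ofReal_of_nonpos (neg_nonpos.2 h), max_eq_left zero_le]

theorem phiQuad_antitone {d : ℕ} (Q : Matrix (Fin d) (Fin d) ℝ) (q : EuclideanSpace ℝ (Fin d))
    (τ : ℝ) (z : EuclideanSpace ℝ (Fin d)) : Antitone fun γ => phiQuad Q q τ γ z := by
  intro γ γ' h
  refine iSup_mono fun v => ENNReal.ofReal_le_ofReal ?_
  gcongr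

theorem quadratic_sub_eq_completed_square {d : ℕ} {Q : Matrix (Fin d) (Fin d) ℝ}
    {γ : ℝ} (hA : (γ • (1 : Matrix (Fin d) (Fin d) ℝ) - Q).PosDef)
    (q v z : EuclideanSpace ℝ (Fin d)) (τ : ℝ) :
    let A := γ • (1 : Matrix (Fin d) (Fin d) ℝ) - Q
    let u := Matrix.toEuclideanLin A⁻¹ (γ • z + q)
    ⟪v, Matrix.toEuclideanLin Q v⟫ + 2 * ⟪q, v⟫ - τ - γ * ‖v - z‖ ^ 2
      = ⟪γ • z + q, u⟫ - γ * ‖z‖ ^ 2 - τ - ⟪v - u, Matrix.toEuclideanLin A (v - u)⟫ := by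
  intro A u
  have hu : Matrix.toEuclideanLin A u = γ • z + q := toEuclideanLin_apply_inv hA _
  have hsymm : ⟪u, Matrix.toEuclideanLin A v⟫ = ⟪γ • z + q, v⟫ := by
    rw [← hu]
    exact (Matrix.isSymmetric_toEuclideanLin_iff.2 hA.isHermitian u v).symm
  have hv : ⟪v, Matrix.toEuclideanLin A v⟫ = γ * ‖v‖ ^ 2 - ⟪v, Matrix.toEuclideanLin Q v⟫ := by
    rw [toEuclideanLin_smul_one_sub, inner_sub_right, inner_smul_right,
      real_inner_self_eq_norm_sq]
  rw [map_sub, inner_sub_left, inner_sub_right, inner_sub_right, hsymm, hv, hu,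
    real_inner_comm v, real_inner_comm u, norm_sub_sq_real]
  simp only [inner_add_left, inner_add_right, real_inner_smul_left, real_inner_smul_right,
    real_inner_comm v z, real_inner_comm v q]
  ring

theorem phiQuad_eq_of_posDef {d : ℕ} {Q : Matrix (Fin d) (Fin d) ℝ} {γ : ℝ} (hγ : 0 ≤ γ)
    (hA : (γ • (1 : Matrix (Fin d) (Fin d) ℝ) - Q).PosDef)
    (q z : EuclideanSpace ℝ (Fin d)) (τ : ℝ) :
    phiQuad Q q τ γ z = ENNReal.ofReal
      (⟪γ • z + q, Matrix.toEuclideanLin (γ • (1 : Matrix (Fin d) (Fin d) ℝ) - Q)⁻¹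
        (γ • z + q)⟫ - γ * ‖z‖ ^ 2 - τ) := by
  rw [phiQuad_eq_iSup Q q hγ]
  refine le_antisymm (iSup_le fun v => ENNReal.ofReal_le_ofReal ?_) ?_
  · rw [quadratic_sub_eq_completed_square hA]
    exact sub_le_self _ ((posSemidef_iff_inner_toEuclideanLin.1 hA.posSemidef).2 _)
  · refine le_trans (le_of_eq ?_) (le_iSup _ (Matrix.toEuclideanLin
      (γ • (1 : Matrix (Fin d) (Fin d) ℝ) - Q)⁻¹ (γ • z + q)))
    rw [quadratic_sub_eq_completed_square hA]
    simp

theorem exists_lt_quadratic {c : ℝ} (hc : 0 < c) (b k : ℝ) : ∃ t : ℝ, k < c * t ^ 2 + b * t := by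
  refine ⟨(|b| + |k|) / c + 1, ?_⟩
  have h1 : c * ((|b| + |k|) / c + 1) = |b| + |k| + c := by field_simp
  have h2 : (0 : ℝ) ≤ (|b| + |k|) / c := by positivity
  have h3 : c * ((|b| + |k|) / c + 1) ^ 2 + b * ((|b| + |k|) / c + 1)
      = (|b| + |k| + c + b) * ((|b| + |k|) / c + 1) := by
    rw [← h1]; ring
  rw [h3]
  have h4 : |k| + c ≤ |b| + |k| + c + b := by linarith [neg_abs_le b]
  nlinarith [le_abs_self k, abs_nonneg k]

theorem phiQuad_eq_top_of_inner_neg {d : ℕ} {Q : Matrix (Fin d) (Fin d) ℝ} {γ : ℝ} (hγ : 0 ≤ γ)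
    {v : EuclideanSpace ℝ (Fin d)}
    (hv : ⟪v, Matrix.toEuclideanLin (γ • (1 : Matrix (Fin d) (Fin d) ℝ) - Q) v⟫ < 0)
    (q z : EuclideanSpace ℝ (Fin d)) (τ : ℝ) : phiQuad Q q τ γ z = ⊤ := by
  rw [phiQuad_eq_iSup Q q hγ, iSup_eq_top]
  intro b hb
  rw [toEuclideanLin_smul_one_sub, inner_sub_right, inner_smul_right,
    real_inner_self_eq_norm_sq] at hv
  obtain ⟨t, ht⟩ := exists_lt_quadratic (neg_pos.2 hv) (2 * ⟪q, v⟫ + 2 * γ * ⟪v, z⟫)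
    (b.toReal + τ + γ * ‖z‖ ^ 2)
  refine ⟨t • v, (ENNReal.lt_ofReal_iff_toReal_lt hb.ne).2 ?_⟩
  rw [norm_sub_sq_real, norm_smul, mul_pow, Real.norm_eq_abs, sq_abs]
  simp only [map_smul, real_inner_smul_left, real_inner_smul_right]
  linarith

theorem posDef_smul_one_sub_of_lt {d : ℕ} {Q : Matrix (Fin d) (Fin d) ℝ} {γ γ' : ℝ} (h : γ < γ')
    (hA : (γ • (1 : Matrix (Fin d) (Fin d) ℝ) - Q).PosSemidef) :
    (γ' • (1 : Matrix (Fin d) (Fin d) ℝ) - Q).PosDef := by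
  have := (Matrix.PosDef.one.smul (sub_pos.2 h)).add_posSemidef hA
  convert this using 1
  rw [sub_smul]
  abel

theorem EReal.le_of_forall_pos_le_perturbed {a : EReal} {τ β γ r : ℝ} (hγ : 0 ≤ γ)
    {I : ℝ≥0∞}
    (h : ∀ ε > 0, a ≤ (τ : EReal) + (β : EReal) *
      ((ENNReal.ofReal ((γ + ε) * r ^ 2) + I : ℝ≥0∞) : EReal)) :
    a ≤ (τ : EReal) + (β : EReal) * ((ENNReal.ofReal (γ * r ^ 2) + I : ℝ≥0∞) : EReal) := by
  induction I with
  | top => simpa using h 1 one_pos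
  | coe I =>
    have key : ∀ x : ℝ, 0 ≤ x → (τ : EReal) + (β : EReal) *
        ((ENNReal.ofReal (x * r ^ 2) + (I : ℝ≥0∞) : ℝ≥0∞) : EReal)
        = ((τ + β * (x * r ^ 2 + I) : ℝ) : EReal) := by
      intro x hx
      have : (0 : ℝ) ≤ x * r ^ 2 := by positivity
      rw [EReal.coe_ennreal_add, EReal.coe_ennreal_ofReal, max_eq_left this]
      push_cast
      rfl
    rw [key γ hγ]
    have hcont : Continuous fun ε : ℝ => ((τ + β * ((γ + ε) * r ^ 2 + I) : ℝ) : EReal) :=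
      continuous_coe_real_ereal.comp (by fun_prop)
    have hlim := (hcont.tendsto 0).mono_left (nhdsWithin_le_nhds (s := Set.Ioi 0))
    rw [add_zero] at hlim
    refine ge_of_tendsto hlim ?_
    filter_upwards [self_mem_nhdsWithin] with ε hε
    rw [← key (γ + ε) (add_nonneg hγ (le_of_lt hε))]
    exact h ε hε

/-- **Restricting the dual feasible set.** Restricting `γ` from `ℝ₊` to
`Γ = {γ ≥ 0 : γI − Q ≻ 0}` does not change the dual infimum, and on `Γ` the inner
supremum `φ` has the closed form `((γz+q)ᵀ(γI−Q)⁻¹(γz+q) − γ‖z‖² − τ)₊`. -/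
theorem dual_restrict_to_Gamma {d : ℕ} (r α : ℝ) (hr : 0 < r) (hα : α ∈ Set.Ioc (0 : ℝ) 1)
    (Q : Matrix (Fin d) (Fin d) ℝ) (hQ : Q.IsSymm) (q : EuclideanSpace ℝ (Fin d))
    (P₀ : Measure (EuclideanSpace ℝ (Fin d))) [IsProbabilityMeasure P₀]
    (hP₀ : Integrable (fun z => ‖z‖ ^ 2) P₀) :
    (⨅ (τ : ℝ) (γ : ℝ) (_ : 0 ≤ γ),
        (τ : EReal) + ((1 / α : ℝ) : EReal) *
          ((ENNReal.ofReal (γ * r ^ 2) + ∫⁻ z, phiQuad Q q τ γ z ∂P₀ : ℝ≥0∞) : EReal))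
      = ⨅ (τ : ℝ) (γ : ℝ)
          (_ : 0 ≤ γ ∧ (γ • (1 : Matrix (Fin d) (Fin d) ℝ) - Q).PosDef),
          (τ : EReal) + ((1 / α : ℝ) : EReal) *
            ((ENNReal.ofReal (γ * r ^ 2) +
              ∫⁻ z, ENNReal.ofReal
                (⟪γ • z + q,
                    Matrix.toEuclideanLin (γ • (1 : Matrix (Fin d) (Fin d) ℝ) - Q)⁻¹
                      (γ • z + q)⟫ - γ * ‖z‖ ^ 2 - τ) ∂P₀ : ℝ≥0∞) : EReal) := by
  have hβ : 0 < 1 / α := one_div_pos.2 hα.1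
  refine le_antisymm ?_ ?_
  · refine iInf_mono fun τ => iInf_mono fun γ => le_iInf fun hγ => iInf_le_of_le hγ.1 ?_
    simp_rw [phiQuad_eq_of_posDef hγ.1 hγ.2]
    exact le_rfl
  · refine iInf_mono fun τ => le_iInf fun γ => le_iInf fun hγ => ?_
    by_cases hA : (γ • (1 : Matrix (Fin d) (Fin d) ℝ) - Q).PosSemidef
    · refine EReal.le_of_forall_pos_le_perturbed hγ fun ε hε => ?_
      have hγε : 0 ≤ γ + ε := by positivity
      have hpd := posDef_smul_one_sub_of_lt (lt_add_of_pos_right γ hε) hA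
      refine iInf_le_of_le (γ + ε) (iInf_le_of_le ⟨hγε, hpd⟩ ?_)
      simp_rw [← phiQuad_eq_of_posDef hγε hpd]
      refine add_le_add le_rfl (mul_le_mul_of_nonneg_left ?_ (EReal.coe_nonneg.2 hβ.le))
      refine EReal.coe_ennreal_le_coe_ennreal_iff.2 (add_le_add le_rfl (lintegral_mono fun z => ?_))
      exact phiQuad_antitone Q q τ z (le_add_of_nonneg_right hε.le)
    · have hherm : (γ • (1 : Matrix (Fin d) (Fin d) ℝ) - Q).IsHermitian := by
        rw [Matrix.IsHermitian, Matrix.conjTranspose_eq_transpose_of_trivial]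
        simp [hQ.eq]
      rw [posSemidef_iff_inner_toEuclideanLin] at hA
      push Not at hA
      obtain ⟨v, hv⟩ := hA hherm
      simp_rw [phiQuad_eq_top_of_inner_neg hγ hv]
      simp [EReal.coe_mul_top_of_pos hβ, -one_div]


end
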